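/- Suppose condition (B_p) holds for some p > 2, and conditions (Q_∞) and (M_L) hold, and Σ_{i∈S} (2c_i + s_i²)π(i) > 0. Let N(n) = max{k : τ_k ≤ n}. Then, as n → ∞, n^{−1} N(n) → π(0) in probability. -/

import Mathlib

open MeasureTheory Filter Topology Asymptotics
open scoped ENNReal NNReal

/-- A time-homogeneous Markov chain on a measurable state space `E`, encoded via the family
`P z` of laws (on trajectory space) of the chain started at `z`.  The field `markov` is the
time-homogeneous Markov property: conditionally on the event `{ω n = w}` intersected with any
event `B` depending only on the first `n+1` coordinates, the shifted trajectory has law `P w`. -/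
structure MChain (E : Type*) [MeasurableSpace E] where
  P : E → MeasureTheory.Measure (ℕ → E)
  isProb : ∀ z, MeasureTheory.IsProbabilityMeasure (P z)
  init : ∀ z, P z {ω | ω 0 = z} = 1
  markov : ∀ (z : E) (n : ℕ) (w : E) (A B : Set (ℕ → E)), MeasurableSet A →
    (∀ ω ω' : ℕ → E, (∀ k, k ≤ n → ω k = ω' k) → ω ∈ B → ω' ∈ B) →
    P z (B ∩ {ω | ω n = w} ∩ {ω | (fun k => ω (n + k)) ∈ A})
      = P z (B ∩ {ω | ω n = w}) * P w A

namespace MChain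

variable {E : Type*} [MeasurableSpace E]

/-- Irreducibility: every state can be reached from every state with positive probability. -/
def Irreducible (X : MChain E) : Prop := ∀ z w : E, ∃ n : ℕ, X.P z {ω | ω n = w} ≠ 0

/-- Recurrence: from every state, the chain returns to it almost surely. -/
def Recurrent (X : MChain E) : Prop := ∀ z : E, X.P z {ω | ∃ n, 1 ≤ n ∧ ω n = z} = 1

def Transient (X : MChain E) : Prop := ¬ X.Recurrent

/-- The first return time to `z` (with junk value `0`, via `sInf ∅ = 0`, if there is no return). -/
noncomputable def returnTime (z : E) (ω : ℕ → E) : ℕ := sInf {n | 1 ≤ n ∧ ω n = z}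

/-- Positive recurrence: recurrent, with finite mean return times. -/
def PositiveRecurrent (X : MChain E) : Prop :=
  X.Recurrent ∧ ∀ z : E, (∫⁻ ω, (returnTime z ω : ℝ≥0∞) ∂(X.P z)) ≠ ⊤

def NullRecurrent (X : MChain E) : Prop := X.Recurrent ∧ ¬ X.PositiveRecurrent

end MChain

section HalfStrip

variable {S : Type*} [Fintype S] [DecidableEq S] [Nonempty S]
  [MeasurableSpace S] [MeasurableSingletonClass S]

/-- `qhat X x i j` is the probability that the `S`-coordinate moves from `i` to `j` when the
`ℕ`-coordinate is at `x`; this is `q_x(i,j) = Σ_y p(x,i,y,j)` of the paper. -/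
noncomputable def qhat (X : MChain (ℕ × S)) (x : ℕ) (i j : S) : ℝ :=
  (X.P (x, i) {ω | (ω 1).2 = j}).toReal

/-- `stepMoment X k x i = μ_k(x,i) = E[(X_{n+1}-X_n)^k | X_n = x, η_n = i]`. -/
noncomputable def stepMoment (X : MChain (ℕ × S)) (k : ℕ) (x : ℕ) (i : S) : ℝ :=
  ∫ ω, (((ω 1).1 : ℝ) - (x : ℝ)) ^ k ∂(X.P (x, i))

/-- Condition (B_p): uniformly bounded conditional `p`-th moments of the jumps of the
`ℕ`-coordinate (by the Markov property, the conditional moment given `F_n` is a function of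
the current state only). -/
def CondB (X : MChain (ℕ × S)) (p : ℝ) : Prop :=
  ∃ C : ℝ≥0∞, C ≠ ⊤ ∧ ∀ (x : ℕ) (i : S),
    (∫⁻ ω, ENNReal.ofReal (|((ω 1).1 : ℝ) - (x : ℝ)| ^ p) ∂(X.P (x, i))) ≤ C

def IsStochasticMatrix (Q : S → S → ℝ) : Prop :=
  (∀ i j, 0 ≤ Q i j) ∧ ∀ i, (∑ j, Q i j) = 1

def IsIrreducibleMatrix (Q : S → S → ℝ) : Prop :=
  ∀ i j, ∃ n : ℕ, 0 < ((Matrix.of Q) ^ n) i j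

/-- Aperiodicity (for a finite irreducible stochastic matrix, eventual positivity of the
diagonal entries of the powers is equivalent to aperiodicity). -/
def IsAperiodicMatrix (Q : S → S → ℝ) : Prop :=
  ∀ i, ∃ N : ℕ, ∀ n, N ≤ n → 0 < ((Matrix.of Q) ^ n) i i

/-- `pst` is a (strictly positive) stationary distribution for `Q`. -/
def IsStationaryDist (Q : S → S → ℝ) (pst : S → ℝ) : Prop :=
  (∀ i, 0 < pst i) ∧ (∑ i, pst i) = 1 ∧ ∀ j, (∑ i, pst i * Q i j) = pst j

/-- Condition (Q_∞): the transition matrix of the `S`-coordinate converges as `x → ∞` to an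
irreducible stochastic matrix `Q`. -/
def CondQ (X : MChain (ℕ × S)) (Q : S → S → ℝ) : Prop :=
  (∀ i j, Tendsto (fun x : ℕ => qhat X x i j) atTop (nhds (Q i j))) ∧
    IsStochasticMatrix Q ∧ IsIrreducibleMatrix Q

/-- Condition (Q_∞^+): as (Q_∞), with a power-law rate of convergence. -/
def CondQplus (X : MChain (ℕ × S)) (Q : S → S → ℝ) : Prop :=
  (∃ δ₀ : ℝ, 0 < δ₀ ∧ ∀ i j,
      (fun x : ℕ => qhat X x i j - Q i j) =O[atTop] fun x : ℕ => (x : ℝ) ^ (-δ₀)) ∧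
    IsStochasticMatrix Q ∧ IsIrreducibleMatrix Q

/-- Condition (M_C): asymptotically constant drifts, `μ₁(x,i) = d_i + o(1)`. -/
def CondMC (X : MChain (ℕ × S)) (d : S → ℝ) : Prop :=
  ∀ i, Tendsto (fun x : ℕ => stepMoment X 1 x i) atTop (nhds (d i))

/-- Condition (M_L): Lamperti-type drifts, `μ₁(x,i) = c_i/x + o(1/x)`, `μ₂(x,i) = s_i² + o(1)`,
with at least one `s_i²` nonzero. -/
def CondML (X : MChain (ℕ × S)) (c s2 : S → ℝ) : Prop :=
  (∀ i, 0 ≤ s2 i) ∧ (∃ i, s2 i ≠ 0) ∧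
    (∀ i, Tendsto (fun x : ℕ => (x : ℝ) * stepMoment X 1 x i) atTop (nhds (c i))) ∧
    (∀ i, Tendsto (fun x : ℕ => stepMoment X 2 x i) atTop (nhds (s2 i)))

/-- Condition (M_L^+): Lamperti-type drifts with power-law error bounds. -/
def CondMLplus (X : MChain (ℕ × S)) (c s2 : S → ℝ) : Prop :=
  (∀ i, 0 ≤ s2 i) ∧ (∃ i, s2 i ≠ 0) ∧
    ∃ δ₁ : ℝ, 0 < δ₁ ∧ ∀ i,
      ((fun x : ℕ => stepMoment X 1 x i - c i / (x : ℝ)) =O[atTop]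
        fun x : ℕ => (x : ℝ) ^ (-1 - δ₁)) ∧
      ((fun x : ℕ => stepMoment X 2 x i - s2 i) =O[atTop] fun x : ℕ => (x : ℝ) ^ (-δ₁))

/-- Successive visit times `τ_0 < τ_1 < ⋯` of the `S`-coordinate to the distinguished state
`s0` (junk value, via `sInf ∅ = 0`, if there is no such visit). -/
noncomputable def tauSeq (s0 : S) (ω : ℕ → ℕ × S) : ℕ → ℕ
  | 0 => sInf {n | (ω n).2 = s0}
  | m + 1 => sInf {n | tauSeq s0 ω m < n ∧ (ω n).2 = s0}

/-- `τ`, the first positive time at which the `S`-coordinate visits `s0`. -/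
noncomputable def tauRet (s0 : S) (ω : ℕ → ℕ × S) : ℕ :=
  sInf {n | 1 ≤ n ∧ (ω n).2 = s0}

/-- `D_n`, the maximal displacement of the `ℕ`-coordinate during the `n`-th excursion. -/
noncomputable def Dexc (s0 : S) (n : ℕ) (ω : ℕ → ℕ × S) : ℕ :=
  Finset.sup (Finset.Icc (tauSeq s0 ω n) (tauSeq s0 ω (n + 1)))
    fun m => Nat.dist (ω m).1 (ω (tauSeq s0 ω n)).1

/-- `N(n) = max {k : τ_k ≤ n}`. -/
noncomputable def Ncount (s0 : S) (n : ℕ) (ω : ℕ → ℕ × S) : ℕ :=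
  sSup {k | tauSeq s0 ω k ≤ n}

end HalfStrip

/-- `Fdist a t` is the distribution function of the square root of a `Gamma(a,t)` random
variable: `F_{a,t}(x) = ∫_0^x 2 u^{2a-1} e^{-u²/t} / (t^a Γ(a)) du`. -/
noncomputable def Fdist (a t x : ℝ) : ℝ :=
  ∫ u in (0:ℝ)..x, 2 * u ^ (2 * a - 1) * Real.exp (-(u ^ 2) / t) / (t ^ a * Real.Gamma a)

variable {S : Type*} [Fintype S] [DecidableEq S] [Nonempty S]
  [MeasurableSpace S] [MeasurableSingletonClass S]

section StochasticMatrix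

variable {ι : Type*} [Fintype ι] [DecidableEq ι]

lemma IsStochasticMatrix.pow {Q : ι → ι → ℝ} (hQ : IsStochasticMatrix Q) (n : ℕ) :
    IsStochasticMatrix ((Matrix.of Q) ^ n) := by
  induction n with
  | zero =>
    refine ⟨fun i j => ?_, fun i => ?_⟩
    · simp only [pow_zero, Matrix.one_apply]; split_ifs <;> norm_num
    · simp [Matrix.one_apply]
  | succ n ih =>
    refine ⟨fun i j => ?_, fun i => ?_⟩
    · rw [pow_succ, Matrix.mul_apply]
      exact Finset.sum_nonneg fun k _ => mul_nonneg (ih.1 i k) (hQ.1 k j)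
    · simp only [pow_succ, Matrix.mul_apply]
      rw [Finset.sum_comm]
      simp only [← Finset.mul_sum, Matrix.of_apply, hQ.2, mul_one, ih.2]

/-- Maximum principle: harmonic functions of an irreducible stochastic matrix are constant. -/
lemma eq_of_harmonic {Q : ι → ι → ℝ} (hQ : IsStochasticMatrix Q) (hirr : IsIrreducibleMatrix Q)
    {h : ι → ℝ} (hh : ∀ i, ∑ j, Q i j * h j = h i) (i j : ι) : h i = h j := by
  have hpow : ∀ n i, ∑ j, ((Matrix.of Q) ^ n) i j * h j = h i := by
    intro n
    induction n with
    | zero => intro i; simp [Matrix.one_apply]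
    | succ n ih =>
      intro i
      simp only [pow_succ, Matrix.mul_apply, Finset.sum_mul]
      rw [Finset.sum_comm]
      simp only [mul_assoc, ← Finset.mul_sum, Matrix.of_apply, hh, ih]
  have : Nonempty ι := ⟨i⟩
  obtain ⟨m, hm⟩ := Finite.exists_max h
  suffices H : ∀ k, h k = h m by rw [H i, H j]
  intro k
  obtain ⟨n, hn⟩ := hirr m k
  have hs := hQ.pow n
  have hsum : ∑ l, ((Matrix.of Q) ^ n) m l * (h m - h l) = 0 := by
    simp only [mul_sub, Finset.sum_sub_distrib, ← Finset.sum_mul, hs.2, hpow, one_mul, sub_self]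
  have := (Finset.sum_eq_zero_iff_of_nonneg fun l _ =>
    mul_nonneg (hs.1 m l) (sub_nonneg.2 (hm l))).1 hsum k (Finset.mem_univ k)
  rcases mul_eq_zero.1 this with h0 | h0
  · exact absurd h0 hn.ne'
  · linarith

/-- Solvability of the Poisson equation for an irreducible stochastic matrix. -/
lemma exists_poisson_solution {Q : ι → ι → ℝ} {w : ι → ℝ} (hQ : IsStochasticMatrix Q)
    (hirr : IsIrreducibleMatrix Q) (hw : IsStationaryDist Q w) (g : ι → ℝ) :
    ∃ h : ι → ℝ, ∀ i, h i - ∑ j, Q i j * h j = g i - ∑ j, g j * w j := by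
  let T : (ι → ℝ) →ₗ[ℝ] (ι → ℝ) :=
    { toFun := fun h i => h i - ∑ j, Q i j * h j + ∑ j, w j * h j
      map_add' := fun a b => by
        ext i; simp only [Pi.add_apply, mul_add, Finset.sum_add_distrib]; ring
      map_smul' := fun r a => by
        ext i
        simp only [Pi.smul_apply, smul_eq_mul, RingHom.id_apply, mul_add, mul_sub,
          Finset.mul_sum, mul_left_comm] }
  have hT : ∀ h i, T h i = h i - ∑ j, Q i j * h j + ∑ j, w j * h j := fun _ _ => rfl
  have hmean : ∀ h, ∑ i, w i * T h i = ∑ j, w j * h j := by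
    intro h
    have h1 : ∑ i, w i * ∑ j, Q i j * h j = ∑ j, w j * h j := by
      simp only [Finset.mul_sum]
      rw [Finset.sum_comm]
      simp only [← mul_assoc, ← Finset.sum_mul, hw.2.2]
    simp only [hT, mul_add, mul_sub, Finset.sum_add_distrib, Finset.sum_sub_distrib, h1,
      ← Finset.sum_mul, hw.2.1]
    ring
  have hinj : Function.Injective T := by
    refine (injective_iff_map_eq_zero T).2 fun h h0 => ?_
    have h1 : ∑ j, w j * h j = 0 := by rw [← hmean, h0]; simp
    have h2 : ∀ i, ∑ j, Q i j * h j = h i := fun i => by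
      have := congrFun h0 i
      rw [hT, h1] at this
      simp only [Pi.zero_apply] at this
      linarith
    ext i
    have h3 : ∑ j, w j * h j = h i := by
      rw [Finset.sum_congr rfl fun j _ => by rw [eq_of_harmonic hQ hirr h2 j i],
        ← Finset.sum_mul, hw.2.1, one_mul]
    rw [← h3, h1]; rfl
  obtain ⟨h, hh⟩ := LinearMap.injective_iff_surjective.1 hinj g
  refine ⟨h, fun i => ?_⟩
  have h1 := hmean h
  have h2 := hT h i
  rw [hh] at h1 h2
  simp only [mul_comm (w _)] at h1 h2
  linarith

end StochasticMatrix

namespace MChain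

section Countable

variable {E : Type*} [MeasurableSpace E]

instance (X : MChain E) (z : E) : IsProbabilityMeasure (X.P z) := X.isProb z

/-- One-step transition probabilities. -/
noncomputable def trans (X : MChain E) (v u : E) : ℝ≥0∞ := X.P v {ω | ω 1 = u}

/-- The σ-algebra generated by the first `n + 1` coordinates. -/
abbrev past (E : Type*) [MeasurableSpace E] (n : ℕ) : MeasurableSpace (ℕ → E) :=
  MeasurableSpace.comap (fun ω (k : Fin (n + 1)) => ω k) inferInstance

lemma past_le (n : ℕ) : past E n ≤ MeasurableSpace.pi :=
  Measurable.comap_le (by fun_prop)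

lemma measurable_eval_past {n k : ℕ} (hk : k ≤ n) : Measurable[past E n] fun ω : ℕ → E => ω k :=
  (measurable_pi_apply (⟨k, by omega⟩ : Fin (n + 1))).comp
    (comap_measurable fun (ω : ℕ → E) (k : Fin (n + 1)) => ω k)

lemma measurableSet_eval_eq [MeasurableSingletonClass E] (n : ℕ) (w : E) :
    MeasurableSet {ω : ℕ → E | ω n = w} :=
  (measurable_pi_apply n : Measurable fun ω : ℕ → E => ω n) (measurableSet_singleton w)

variable [Countable E] [MeasurableSingletonClass E]

lemma lintegral_comp_eval (μ : Measure (ℕ → E)) (n : ℕ) (φ : E → ℝ≥0∞) :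
    ∫⁻ ω, φ (ω n) ∂μ = ∑' w, φ w * μ {ω | ω n = w} := by
  have hm : Measurable fun ω : ℕ → E => ω n := measurable_pi_apply n
  rw [← lintegral_map (f := φ) (measurable_of_countable φ) hm, lintegral_countable']
  refine tsum_congr fun w => ?_
  rw [Measure.map_apply hm (measurableSet_singleton w)]
  rfl

lemma measure_eq_tsum_eval (μ : Measure (ℕ → E)) (n : ℕ) (s : Set (ℕ → E)) :
    μ s = ∑' w, μ (s ∩ {ω | ω n = w}) := by
  have h := lintegral_comp_eval (μ.restrict s) n fun _ => 1
  simp only [lintegral_one, Measure.restrict_apply_univ, one_mul] at h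
  rw [h]
  refine tsum_congr fun w => ?_
  rw [Measure.restrict_apply (measurableSet_eval_eq n w), Set.inter_comm]

lemma measure_past_inter_shift (X : MChain E) (z : E) (n : ℕ) {A : Set (ℕ → E)}
    (hA : MeasurableSet A) {s : Set (ℕ → E)} (hs : MeasurableSet[past E n] s) :
    X.P z (s ∩ {ω | (fun k => ω (n + k)) ∈ A}) = ∫⁻ ω in s, X.P (ω n) A ∂(X.P z) := by
  rw [lintegral_comp_eval _ n fun w => X.P w A, measure_eq_tsum_eval _ n]
  refine tsum_congr fun w => ?_
  rw [Measure.restrict_apply (measurableSet_eval_eq n w),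
    Set.inter_right_comm, X.markov z n w A s hA, Set.inter_comm s, mul_comm]
  obtain ⟨t, -, rfl⟩ := hs
  intro ω ω' h hω
  have : (fun k : Fin (n + 1) => ω k) = fun k : Fin (n + 1) => ω' k :=
    funext fun k => h k (by omega)
  simpa only [Set.mem_preimage, this] using hω

lemma measure_eval_succ (X : MChain E) (z : E) (n : ℕ) (u : E) :
    X.P z {ω | ω (n + 1) = u} = ∑' v, X.P z {ω | ω n = v} * X.trans v u := by
  have h := X.measure_past_inter_shift z n (A := {ω | ω 1 = u})
    (measurableSet_eval_eq 1 u) (@MeasurableSet.univ _ (past E n))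
  rw [Measure.restrict_univ, lintegral_comp_eval _ n fun w => X.P w {ω | ω 1 = u}] at h
  simpa [trans, mul_comm] using h

/-- The Markov property in integrated form. -/
lemma integral_mul_shift (X : MChain E) (z : E) (n : ℕ) {A : Set (ℕ → E)}
    (hA : MeasurableSet A) {G : (ℕ → E) → ℝ} (hG : Measurable[past E n] G) {C : ℝ}
    (hC : ∀ ω, |G ω| ≤ C) :
    ∫ ω, G ω * {ω | (fun k => ω (n + k)) ∈ A}.indicator 1 ω ∂(X.P z)
      = ∫ ω, G ω * (X.P (ω n) A).toReal ∂(X.P z) := by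
  have hm := past_le (E := E) n
  have hB : MeasurableSet {ω : ℕ → E | (fun k => ω (n + k)) ∈ A} := by
    have : Measurable fun (ω : ℕ → E) k => ω (n + k) := by fun_prop
    exact this hA
  set f : (ℕ → E) → ℝ := {ω | (fun k => ω (n + k)) ∈ A}.indicator 1 with hf
  have hfi : Integrable f (X.P z) := (integrable_const (1 : ℝ)).indicator hB
  have hgm : Measurable[past E n] fun ω : ℕ → E => (X.P (ω n) A).toReal :=
    (measurable_of_countable fun w => (X.P w A).toReal).comp (measurable_eval_past le_rfl)
  have hgi : Integrable (fun ω => (X.P (ω n) A).toReal) (X.P z) :=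
    Integrable.of_bound (hgm.mono hm le_rfl).aestronglyMeasurable 1 (ae_of_all _ fun ω => by
      rw [Real.norm_of_nonneg ENNReal.toReal_nonneg]
      exact ENNReal.toReal_le_of_le_ofReal zero_le_one (by simpa using prob_le_one))
  have hce : (fun ω => (X.P (ω n) A).toReal) =ᵐ[X.P z] (X.P z)[f|past E n] := by
    refine ae_eq_condExp_of_forall_setIntegral_eq hm hfi (fun s _ _ => hgi.integrableOn)
      (fun s hs _ => ?_) hgm.stronglyMeasurable.aestronglyMeasurable
    rw [integral_toReal ((hgm.mono hm le_rfl).ennreal_ofReal.aemeasurable.congr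
        (ae_of_all _ fun ω => ENNReal.ofReal_toReal (measure_ne_top _ _)))
      (ae_of_all _ fun ω => measure_lt_top _ _), ← X.measure_past_inter_shift z n hA hs, hf,
      integral_indicator_one hB, Measure.real, Measure.restrict_apply hB, Set.inter_comm]
  have hGf : Integrable (G * f) (X.P z) :=
    hfi.bdd_mul (c := C) (hG.mono hm le_rfl).aestronglyMeasurable (ae_of_all _ hC)
  calc ∫ ω, G ω * f ω ∂(X.P z) = ∫ ω, ((X.P z)[G * f|past E n]) ω ∂(X.P z) :=
        (integral_condExp hm).symm
    _ = ∫ ω, G ω * (X.P (ω n) A).toReal ∂(X.P z) := by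
        refine integral_congr_ae ?_
        filter_upwards [condExp_mul_of_stronglyMeasurable_left hG.stronglyMeasurable hGf hfi, hce]
          with ω h1 h2
        rw [h1, Pi.mul_apply, ← h2]

end Countable

end MChain

namespace MChain

section Occupation

variable {E : Type*} [MeasurableSpace E]

/-- The expected fraction of the first `n` steps spent at `v` by the chain started at `z`. -/
noncomputable def occupation (X : MChain E) (z : E) (n : ℕ) (v : E) : ℝ≥0∞ :=
  (∑ k ∈ Finset.range n, X.P z {ω | ω k = v}) / n

variable [Countable E] [MeasurableSingletonClass E]

lemma tsum_measure_eval (X : MChain E) (z : E) (k : ℕ) : ∑' v, X.P z {ω | ω k = v} = 1 := by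
  have := measure_eq_tsum_eval (X.P z) k Set.univ
  simpa using this.symm

lemma tsum_occupation_le (X : MChain E) (z : E) (n : ℕ) : ∑' v, X.occupation z n v ≤ 1 := by
  simp only [occupation, div_eq_mul_inv]
  rw [ENNReal.tsum_mul_right, Summable.tsum_finsetSum fun _ _ => ENNReal.summable]
  simp only [tsum_measure_eval, Finset.sum_const, Finset.card_range, nsmul_eq_mul, mul_one]
  exact ENNReal.div_self_le_one

lemma tsum_occupation_mul_trans_le (X : MChain E) (z : E) (n : ℕ) (u : E) :
    ∑' v, X.occupation z n v * X.trans v u ≤ X.occupation z n u + (n : ℝ≥0∞)⁻¹ := by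
  have h : ∑' v, X.occupation z n v * X.trans v u
      = (∑ k ∈ Finset.range n, X.P z {ω | ω (k + 1) = u}) / n := by
    simp only [occupation, div_eq_mul_inv, mul_right_comm _ _ (X.trans _ _)]
    rw [ENNReal.tsum_mul_right]
    simp only [Finset.sum_mul (Finset.range n) _ (X.trans _ _)]
    rw [Summable.tsum_finsetSum fun _ _ => ENNReal.summable]
    simp only [measure_eval_succ]
  rw [h, occupation, ← one_div, ENNReal.div_add_div_same]
  gcongr
  calc ∑ k ∈ Finset.range n, X.P z {ω | ω (k + 1) = u}
      ≤ ∑ k ∈ Finset.range (n + 1), X.P z {ω | ω k = u} := by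
        rw [Finset.sum_range_succ']; exact le_self_add
    _ ≤ _ := by rw [Finset.sum_range_succ]; gcongr; exact prob_le_one

/-- If the occupation of some state does not vanish, there is a finite, strictly positive
subinvariant measure. -/
lemma exists_subinvariant (X : MChain E) (hirr : X.Irreducible) {z w : E}
    (hzw : ¬ Tendsto (fun n => X.occupation z n w) atTop (𝓝 0)) :
    ∃ ν : E → ℝ≥0∞, ∑' v, ν v ≤ 1 ∧ (∀ v, 0 < ν v) ∧
      ∀ u, ∑' v, ν v * X.trans v u ≤ ν u := by
  simp only [ENNReal.tendsto_nhds_zero, not_forall, exists_prop, gt_iff_lt] at hzw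
  obtain ⟨ε, hε, hfr⟩ := hzw
  have hfr : ∃ᶠ n in atTop, ε ≤ X.occupation z n w :=
    (not_eventually.1 hfr).mono fun n hn => (not_le.1 hn).le
  have hne := frequently_iff_neBot.1 hfr
  let U : Ultrafilter ℕ := Ultrafilter.of (atTop ⊓ 𝓟 {n | ε ≤ X.occupation z n w})
  have hU : (U : Filter ℕ) ≤ atTop ⊓ 𝓟 {n | ε ≤ X.occupation z n w} := Ultrafilter.of_le _
  have hlim : ∀ v, ∃ l, Tendsto (fun n => X.occupation z n v) U (𝓝 l) := fun v => by
    obtain ⟨l, -, hl⟩ := isCompact_univ.ultrafilter_le_nhds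
      (U.map fun n => X.occupation z n v) (by simp)
    exact ⟨l, hl⟩
  choose ν hν using hlim
  have hinv : ∀ u, ∑' v, ν v * X.trans v u ≤ ν u := fun u => by
    have hR : Tendsto (fun n => X.occupation z n u + (n : ℝ≥0∞)⁻¹) U (𝓝 (ν u)) := by
      simpa using (hν u).add (ENNReal.tendsto_inv_nat_nhds_zero.mono_left (hU.trans inf_le_left))
    rw [ENNReal.tsum_eq_iSup_sum]
    refine iSup_le fun s => le_of_tendsto_of_tendsto (tendsto_finsetSum s fun v _ =>
      ENNReal.Tendsto.mul_const (hν v) (Or.inr (measure_ne_top _ _))) hR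
      (Eventually.of_forall fun n => (ENNReal.sum_le_tsum s).trans
        (X.tsum_occupation_mul_trans_le z n u))
  have hstep : ∀ n v u, 0 < ν v → X.P v {ω | ω n = u} ≠ 0 → 0 < ν u := by
    intro n
    induction n with
    | zero =>
      intro v u hv h0
      by_cases hvu : v = u
      · exact hvu ▸ hv
      · have hsub : {ω : ℕ → E | ω 0 = u} ⊆ {ω | ω 0 = v}ᶜ := fun ω hω h => hvu (h.symm.trans hω)
        exact absurd (measure_mono_null hsub
          ((prob_compl_eq_zero_iff (measurableSet_eval_eq 0 v)).2 (X.init v))) h0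
    | succ n ih =>
      intro v u hv h0
      rw [measure_eval_succ, Ne, ENNReal.tsum_eq_zero, not_forall] at h0
      obtain ⟨y, hy⟩ := h0
      rw [mul_eq_zero, not_or] at hy
      calc 0 < ν y * X.trans y u :=
            ENNReal.mul_pos (ih v y hv hy.1).ne' hy.2
        _ ≤ ∑' v, ν v * X.trans v u := ENNReal.le_tsum y
        _ ≤ ν u := hinv u
  have hw : 0 < ν w := hε.trans_le <| ge_of_tendsto (hν w) <|
    (hU.trans inf_le_right) (mem_principal_self _)
  refine ⟨ν, ?_, fun v => (hirr w v).elim fun n hn => hstep n w v hw hn, hinv⟩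
  rw [ENNReal.tsum_eq_iSup_sum]
  exact iSup_le fun s => le_of_tendsto (tendsto_finsetSum s fun v _ => hν v)
    (Eventually.of_forall fun n => (ENNReal.sum_le_tsum s).trans (X.tsum_occupation_le z n))

lemma tsum_mul_occupation (X : MChain E) (z : E) (n : ℕ) (φ : E → ℝ≥0∞) :
    ∑' v, φ v * X.occupation z n v
      = (∑ k ∈ Finset.range n, ∫⁻ ω, φ (ω k) ∂(X.P z)) / n := by
  simp only [occupation, div_eq_mul_inv, ← mul_assoc, Finset.mul_sum]
  rw [ENNReal.tsum_mul_right, Summable.tsum_finsetSum fun _ _ => ENNReal.summable]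
  simp only [lintegral_comp_eval]

lemma tendsto_average_of_tendsto_occupation (X : MChain E) {z : E}
    (h : ∀ w, Tendsto (fun n => X.occupation z n w) atTop (𝓝 0)) {φ : E → ℝ≥0∞} {C : ℝ≥0∞}
    (hC : C ≠ ⊤) (hφC : ∀ v, φ v ≤ C) (hφ : ∀ ε, 0 < ε → {v | ε < φ v}.Finite) :
    Tendsto (fun n : ℕ => (∑ k ∈ Finset.range n, ∫⁻ ω, φ (ω k) ∂(X.P z)) / n) atTop (𝓝 0) := by
  simp only [← tsum_mul_occupation]
  rw [ENNReal.tendsto_nhds_zero]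
  intro ε hε
  have hε2 : 0 < ε / 2 := ENNReal.half_pos hε.ne'
  set T := (hφ _ hε2).toFinset
  have hT : Tendsto (fun n => ∑ v ∈ T, C * X.occupation z n v) atTop (𝓝 0) := by
    simpa using tendsto_finsetSum T fun v _ => ENNReal.Tendsto.const_mul (h v) (Or.inr hC)
  filter_upwards [ENNReal.tendsto_nhds_zero.1 hT _ hε2] with n hn
  calc ∑' v, φ v * X.occupation z n v
      ≤ ∑' v, ((T : Set E).indicator (fun v => C * X.occupation z n v) v
          + ε / 2 * X.occupation z n v) := by
        refine ENNReal.tsum_le_tsum fun v => ?_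
        by_cases hv : v ∈ (T : Set E)
        · rw [Set.indicator_of_mem hv]
          exact le_add_right (by gcongr; exact hφC v)
        · rw [Set.indicator_of_notMem hv, zero_add]
          gcongr
          simpa [T] using hv
    _ ≤ ε / 2 + ε / 2 * 1 := by
        rw [ENNReal.tsum_add, ← sum_eq_tsum_indicator, ENNReal.tsum_mul_left]
        gcongr
        exact X.tsum_occupation_le z n
    _ = ε := by rw [mul_one, ENNReal.add_halves]

end Occupation

end MChain

namespace MChain

section Lyapunov

/-- A smooth bounded truncation of the identity on `[0, ∞)`. -/
noncomputable def softTrunc (K y : ℝ) : ℝ := K * y / (K + y)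

lemma softTrunc_nonneg {K y : ℝ} (hK : 0 < K) (hy : 0 ≤ y) : 0 ≤ softTrunc K y := by
  unfold softTrunc; positivity

lemma softTrunc_le {K y : ℝ} (hK : 0 < K) (hy : 0 ≤ y) : softTrunc K y ≤ K := by
  unfold softTrunc
  rw [div_le_iff₀ (by positivity)]
  nlinarith

lemma softTrunc_le_self {K y : ℝ} (hK : 0 < K) (hy : 0 ≤ y) : softTrunc K y ≤ y := by
  unfold softTrunc
  rw [div_le_iff₀ (by positivity)]
  nlinarith

lemma tendsto_softTrunc {y : ℝ} (hy : 0 ≤ y) :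
    Tendsto (fun n : ℕ => softTrunc ((n : ℝ) + 1) y) atTop (𝓝 y) := by
  have h : Tendsto (fun n : ℕ => y - y ^ 2 / ((n : ℝ) + 1 + y)) atTop (𝓝 (y - 0)) := by
    refine tendsto_const_nhds.sub (Tendsto.div_atTop tendsto_const_nhds ?_)
    exact (tendsto_natCast_atTop_atTop.atTop_add tendsto_const_nhds).atTop_add tendsto_const_nhds
  rw [sub_zero] at h
  refine h.congr fun n => ?_
  unfold softTrunc
  have : (n : ℝ) + 1 + y ≠ 0 := by positivity
  field_simp
  ring

lemma abs_softTrunc_sub_le {K : ℝ} (hK : 0 < K) (r s : ℝ) :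
    |softTrunc K (s ^ 2) - softTrunc K (r ^ 2) - (K / (K + r ^ 2)) ^ 2 * (s ^ 2 - r ^ 2)|
      ≤ 4 * (s - r) ^ 2 := by
  have h1 : 0 < K + r ^ 2 := by positivity
  have h2 : 0 < K + s ^ 2 := by positivity
  have h : softTrunc K (s ^ 2) - softTrunc K (r ^ 2) - (K / (K + r ^ 2)) ^ 2 * (s ^ 2 - r ^ 2)
      = -((s - r) ^ 2 * (K ^ 2 * (s + r) ^ 2 / ((K + r ^ 2) ^ 2 * (K + s ^ 2)))) := by
    unfold softTrunc
    field_simp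
    ring
  have h3 : K ^ 2 * (s + r) ^ 2 / ((K + r ^ 2) ^ 2 * (K + s ^ 2)) ≤ 4 := by
    rw [div_le_iff₀ (by positivity)]
    have e1 : (s + r) ^ 2 ≤ 2 * s ^ 2 + 2 * r ^ 2 := by nlinarith [sq_nonneg (s - r)]
    have e2 : K ^ 2 * (s + r) ^ 2 ≤ K ^ 2 * (2 * s ^ 2 + 2 * r ^ 2) := by gcongr
    have e3 : 0 ≤ K * r ^ 2 * s ^ 2 := by positivity
    have e4 : 0 ≤ r ^ 4 * (K + s ^ 2) := by positivity
    have e5 : 0 ≤ K ^ 2 * r ^ 2 := by positivity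
    have e6 : 0 ≤ K ^ 2 * s ^ 2 := by positivity
    have e7 : 0 ≤ K ^ 3 := by positivity
    nlinarith
  rw [h, abs_neg, abs_of_nonneg (by positivity), mul_comm 4]
  gcongr

variable {E : Type*} [MeasurableSpace E] [Countable E] [MeasurableSingletonClass E]

/-- A nonnegative subharmonic function with bounded drift whose square root has increments of
bounded second moment is harmonic, in the presence of a positive finite subinvariant measure. -/
lemma drift_eq_zero_of_subinvariant (X : MChain E) {ν : E → ℝ≥0∞} (hν1 : ∑' v, ν v ≤ 1)
    (hν0 : ∀ v, 0 < ν v) (hν : ∀ u, ∑' v, ν v * X.trans v u ≤ ν u) {r : E → ℝ}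
    {C : ℝ}
    (hint : ∀ v, Integrable (fun ω => r (ω 1) ^ 2) (X.P v))
    (hint' : ∀ v, Integrable (fun ω => (r (ω 1) - r v) ^ 2) (X.P v))
    (hsq : ∀ v, ∫ ω, (r (ω 1) - r v) ^ 2 ∂(X.P v) ≤ C)
    (hd0 : ∀ v, 0 ≤ ∫ ω, r (ω 1) ^ 2 ∂(X.P v) - r v ^ 2)
    (hdC : ∀ v, ∫ ω, r (ω 1) ^ 2 ∂(X.P v) - r v ^ 2 ≤ C) (v : E) :
    ∫ ω, r (ω 1) ^ 2 ∂(X.P v) - r v ^ 2 = 0 := by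
  set d : E → ℝ := fun v => ∫ ω, r (ω 1) ^ 2 ∂(X.P v) - r v ^ 2 with hd
  let m : Measure E := Measure.sum fun v => ν v • Measure.dirac v
  have hm : ∀ φ : E → ℝ≥0∞, ∫⁻ v, φ v ∂m = ∑' v, φ v * ν v := fun φ => by
    simp [m, lintegral_sum_measure, lintegral_smul_measure, mul_comm]
  have : IsFiniteMeasure m := ⟨by
    have := hm fun _ => 1
    simp only [lintegral_one, one_mul] at this
    rw [this]; exact hν1.trans_lt ENNReal.one_lt_top⟩
  have hmeas : ∀ φ : E → ℝ, Measurable φ := fun φ => measurable_of_countable φ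
  have hev : Measurable fun ω : ℕ → E => ω 1 := measurable_pi_apply 1
  let P : ℕ → E → ℝ := fun n v => ∫ ω, softTrunc ((n : ℝ) + 1) (r (ω 1) ^ 2) ∂(X.P v)
  let B : ℕ → E → ℝ := fun n v => softTrunc ((n : ℝ) + 1) (r v ^ 2)
  have hK : ∀ n : ℕ, (0 : ℝ) < (n : ℝ) + 1 := fun n => by positivity
  have hB0 : ∀ n v, 0 ≤ B n v := fun n v => softTrunc_nonneg (hK n) (sq_nonneg _)
  have hB1 : ∀ n v, B n v ≤ (n : ℝ) + 1 := fun n v => softTrunc_le (hK n) (sq_nonneg _)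
  have hBi : ∀ n v, Integrable (fun ω => B n (ω 1)) (X.P v) := fun n v =>
    Integrable.of_bound ((hmeas (B n)).comp hev).aestronglyMeasurable ((n : ℝ) + 1)
      (ae_of_all _ fun ω => by rw [Real.norm_of_nonneg (hB0 _ _)]; exact hB1 _ _)
  have hBm : ∀ n, Integrable (B n) m := fun n =>
    Integrable.of_bound (hmeas (B n)).aestronglyMeasurable ((n : ℝ) + 1)
      (ae_of_all _ fun v => by rw [Real.norm_of_nonneg (hB0 _ _)]; exact hB1 _ _)
  have hP0 : ∀ n v, 0 ≤ P n v := fun n v => integral_nonneg fun ω => hB0 n (ω 1)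
  have hP1 : ∀ n v, P n v ≤ (n : ℝ) + 1 := fun n v => by
    have := integral_mono (hBi n v) (integrable_const ((n : ℝ) + 1)) fun ω => hB1 n (ω 1)
    simpa using this
  have hPm : ∀ n, Integrable (P n) m := fun n =>
    Integrable.of_bound (hmeas (P n)).aestronglyMeasurable ((n : ℝ) + 1)
      (ae_of_all _ fun v => by rw [Real.norm_of_nonneg (hP0 _ _)]; exact hP1 _ _)
  have hle : ∀ n, ∫ v, (P n v - B n v) ∂m ≤ 0 := by
    intro n
    rw [integral_sub (hPm n) (hBm n), sub_nonpos,
      integral_eq_lintegral_of_nonneg_ae (ae_of_all _ (hP0 n)) (hmeas _).aestronglyMeasurable,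
      integral_eq_lintegral_of_nonneg_ae (ae_of_all _ (hB0 n)) (hmeas _).aestronglyMeasurable]
    refine ENNReal.toReal_mono (hBm n).lintegral_lt_top.ne ?_
    have e : ∀ v, ENNReal.ofReal (P n v) = ∑' u, ENNReal.ofReal (B n u) * X.trans v u := fun v => by
      rw [ofReal_integral_eq_lintegral_ofReal (hBi n v) (ae_of_all _ fun ω => hB0 n (ω 1)),
        lintegral_comp_eval _ 1 fun u => ENNReal.ofReal (B n u)]
      rfl
    simp only [hm, e, ← ENNReal.tsum_mul_right]
    rw [ENNReal.tsum_comm]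
    refine ENNReal.tsum_le_tsum fun u => ?_
    simp only [mul_assoc, ENNReal.tsum_mul_left, mul_comm (X.trans _ _)]
    gcongr
    exact hν u
  have hlim : ∀ v, Tendsto (fun n => P n v - B n v) atTop (𝓝 (d v)) := fun v => by
    refine Tendsto.sub (tendsto_integral_of_dominated_convergence (fun ω => r (ω 1) ^ 2)
      (fun n => (hBi n v).aestronglyMeasurable) (hint v) (fun n => ae_of_all _ fun ω => ?_)
      (ae_of_all _ fun ω => tendsto_softTrunc (sq_nonneg _))) (tendsto_softTrunc (sq_nonneg _))
    rw [Real.norm_of_nonneg (hB0 n (ω 1))]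
    exact softTrunc_le_self (hK n) (sq_nonneg _)
  have hbound : ∀ n v, ‖P n v - B n v‖ ≤ 5 * C := fun n v => by
    set a : ℝ := (((n : ℝ) + 1) / ((n : ℝ) + 1 + r v ^ 2)) ^ 2 with ha
    have ha0 : 0 ≤ a := sq_nonneg _
    have ha1 : a ≤ 1 := by
      refine pow_le_one₀ (by positivity) ?_
      rw [div_le_one (by positivity)]
      nlinarith [sq_nonneg (r v)]
    have e : P n v - B n v - a * d v
        = ∫ ω, (B n (ω 1) - B n v - a * (r (ω 1) ^ 2 - r v ^ 2)) ∂(X.P v) := by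
      have i1 : Integrable (fun ω => B n (ω 1) - B n v) (X.P v) :=
        (hBi n v).sub (integrable_const (B n v))
      have i2 : Integrable (fun ω => a * (r (ω 1) ^ 2 - r v ^ 2)) (X.P v) :=
        ((hint v).sub (integrable_const (r v ^ 2))).const_mul a
      rw [integral_sub i1 i2, integral_sub (hBi n v) (integrable_const _), integral_const_mul,
        integral_sub (hint v) (integrable_const _)]
      simp [P, B, hd]
    have e2 : |P n v - B n v - a * d v| ≤ 4 * C := by
      rw [e]
      refine abs_integral_le_integral_abs.trans ?_
      calc _ ≤ ∫ ω, 4 * (r (ω 1) - r v) ^ 2 ∂(X.P v) := by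
            refine integral_mono_of_nonneg (ae_of_all _ fun _ => abs_nonneg _)
              ((hint' v).const_mul 4) (ae_of_all _ fun ω => ?_)
            exact abs_softTrunc_sub_le (hK n) (r v) (r (ω 1))
        _ ≤ 4 * C := by rw [integral_const_mul]; linarith [hsq v]
    have := abs_le.1 e2
    have h0 := hd0 v
    have h1 := hdC v
    have h2 : 0 ≤ a * d v := mul_nonneg ha0 h0
    have h3 : a * d v ≤ d v := mul_le_of_le_one_left h0 ha1
    rw [Real.norm_eq_abs, abs_le]
    constructor <;> linarith [this.1, this.2]
  have hfin : ∫ v, d v ∂m ≤ 0 := le_of_tendsto' (tendsto_integral_of_dominated_convergence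
    (fun _ => 5 * C) (fun n => (hmeas _).aestronglyMeasurable) (integrable_const _)
    (fun n => ae_of_all _ (hbound n)) (ae_of_all _ hlim)) hle
  have hdi : Integrable d m := Integrable.of_bound (hmeas _).aestronglyMeasurable C
    (ae_of_all _ fun v => by rw [Real.norm_of_nonneg (hd0 v)]; exact hdC v)
  have hae := (integral_eq_zero_iff_of_nonneg hd0 hdi).1 (hfin.antisymm (integral_nonneg hd0))
  by_contra hne
  have h0 : m {v | d v ≠ 0} = 0 := hae
  have h1 : m {v} = 0 := measure_mono_null (by simpa using hne) h0
  have h2 := hm (({v} : Set E).indicator 1)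
  rw [lintegral_indicator_one (measurableSet_singleton v), h1] at h2
  have h3 := ENNReal.tsum_eq_zero.1 h2.symm v
  simp only [Set.mem_singleton_iff, Set.indicator_of_mem, Pi.one_apply, one_mul] at h3
  exact (hν0 v).ne' h3

end Lyapunov

end MChain

lemma exists_abs_le_of_tendsto {ι : Type*} [Fintype ι] {D : ℕ → ι → ℝ} {l : ℝ}
    (hD : ∀ i, Tendsto (fun x => D x i) atTop (𝓝 l)) : ∃ M, ∀ x i, |D x i| ≤ M := by
  have h : ∀ i, ∃ M, ∀ x, |D x i| ≤ M := fun i => by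
    obtain ⟨M, hM⟩ := (hD i).abs.bddAbove_range
    exact ⟨M, fun x => hM ⟨x, rfl⟩⟩
  choose M hM using h
  refine ⟨∑ i, |M i|, fun x i => (hM i x).trans ((le_abs_self _).trans ?_)⟩
  exact Finset.single_le_sum (f := fun i => |M i|) (fun j _ => abs_nonneg _) (Finset.mem_univ i)

lemma sq_sqrt_posPart_sub_le {x u A : ℝ} (hx : 0 ≤ x) (hu : |u| ≤ A) :
    (√(max (x ^ 2 + u) 0) - x) ^ 2 ≤ A := by
  set r := √(max (x ^ 2 + u) 0) with hr
  have hr0 : 0 ≤ r := Real.sqrt_nonneg _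
  have hr2 : r ^ 2 = max (x ^ 2 + u) 0 := Real.sq_sqrt (le_max_right _ _)
  have hu' := abs_le.1 hu
  have h1 : |r ^ 2 - x ^ 2| ≤ A := by
    rw [hr2, abs_le]
    rcases max_cases (x ^ 2 + u) 0 with ⟨h, h'⟩ | ⟨h, h'⟩ <;> rw [h] <;>
      constructor <;> nlinarith
  have h2 := abs_le.1 h1
  rcases le_total r x with h | h <;> nlinarith

section NullOccupation

variable {ι : Type*} [Fintype ι] [MeasurableSpace ι] [MeasurableSingletonClass ι]

lemma integral_comp_snd (X : MChain (ℕ × ι)) (x : ℕ) (i : ι) (g : ι → ℝ) :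
    ∫ ω, g (ω 1).2 ∂(X.P (x, i)) = ∑ j, qhat X x i j * g j := by
  classical
  have hm : Measurable fun ω : ℕ → ℕ × ι => (ω 1).2 := measurable_snd.comp (measurable_pi_apply 1)
  have e : ∀ ω : ℕ → ℕ × ι, g (ω 1).2
      = ∑ j, {ω : ℕ → ℕ × ι | (ω 1).2 = j}.indicator (fun _ => g j) ω := fun ω => by
    simp [Set.indicator_apply]
  have hs : ∀ j, MeasurableSet {ω : ℕ → ℕ × ι | (ω 1).2 = j} := fun j =>
    hm (measurableSet_singleton j)
  simp only [e]
  rw [integral_finsetSum _ fun j _ => (integrable_const _).indicator (hs j)]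
  refine Finset.sum_congr rfl fun j _ => ?_
  rw [integral_indicator_const _ (hs j), smul_eq_mul]
  rfl

lemma CondB.exists_integral_sq_le {X : MChain (ℕ × ι)} {p : ℝ} (hp : 2 < p) (hB : CondB X p) :
    ∃ C : ℝ, ∀ (x : ℕ) (i : ι), Integrable (fun ω => (((ω 1).1 : ℝ) - x) ^ 2) (X.P (x, i)) ∧
      ∫ ω, (((ω 1).1 : ℝ) - x) ^ 2 ∂(X.P (x, i)) ≤ C := by
  obtain ⟨C, hC, h⟩ := hB
  refine ⟨(1 + C).toReal, fun x i => ?_⟩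
  have hm : Measurable fun ω : ℕ → ℕ × ι => (((ω 1).1 : ℝ) - x) ^ 2 :=
    (measurable_of_countable fun v : ℕ × ι => ((v.1 : ℝ) - x) ^ 2).comp (measurable_pi_apply 1)
  have hle : ∫⁻ ω, ENNReal.ofReal ((((ω 1).1 : ℝ) - x) ^ 2) ∂(X.P (x, i)) ≤ 1 + C := by
    calc _ ≤ ∫⁻ ω, (1 + ENNReal.ofReal (|((ω 1).1 : ℝ) - x| ^ p)) ∂(X.P (x, i)) := by
          refine lintegral_mono fun ω => ?_
          rw [← ENNReal.ofReal_one, ← ENNReal.ofReal_add zero_le_one (by positivity)]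
          refine ENNReal.ofReal_le_ofReal ?_
          set t := |((ω 1).1 : ℝ) - x| with ht
          rw [← sq_abs, ← ht]
          have ht0 : 0 ≤ t := abs_nonneg _
          rcases le_total t 1 with h1 | h1
          · have : t ^ 2 ≤ 1 := pow_le_one₀ ht0 h1
            have : 0 ≤ t ^ p := by positivity
            linarith
          · have : t ^ (2 : ℝ) ≤ t ^ p := Real.rpow_le_rpow_of_exponent_le h1 hp.le
            rw [Real.rpow_two] at this
            linarith
      _ ≤ 1 + C := by
          rw [lintegral_add_left measurable_const, lintegral_one, measure_univ]
          gcongr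
          exact h x i
  have hfin : (1 + C) ≠ ⊤ := ENNReal.add_ne_top.2 ⟨ENNReal.one_ne_top, hC⟩
  refine ⟨⟨hm.aestronglyMeasurable, ?_⟩, ?_⟩
  · rw [hasFiniteIntegral_iff_ofReal (ae_of_all _ fun ω => sq_nonneg _)]
    exact hle.trans_lt hfin.lt_top
  · rw [integral_eq_lintegral_of_nonneg_ae (ae_of_all _ fun ω => sq_nonneg _)
      hm.aestronglyMeasurable]
    exact ENNReal.toReal_mono hfin hle

/-- The expected fraction of time spent at any given state vanishes. -/
theorem tendsto_occupation_zero [DecidableEq ι] {X : MChain (ℕ × ι)} (hirr : X.Irreducible)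
    {p : ℝ} (hp : 2 < p) (hB : CondB X p) {Q : ι → ι → ℝ} {w : ι → ℝ} (hQ : CondQ X Q)
    (hw : IsStationaryDist Q w) {c s2 : ι → ℝ} (hML : CondML X c s2)
    (hpos : 0 < ∑ i, (2 * c i + s2 i) * w i) (z v : ℕ × ι) :
    Tendsto (fun n => X.occupation z n v) atTop (𝓝 0) := by
  by_contra hcon
  obtain ⟨ν, hν1, hν0, hν⟩ := X.exists_subinvariant hirr hcon
  obtain ⟨b, hb⟩ := exists_poisson_solution hQ.2.1 hQ.2.2 hw fun i => 2 * c i + s2 i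
  set l := ∑ i, (2 * c i + s2 i) * w i with hl
  obtain ⟨C, hC⟩ := hB.exists_integral_sq_le hp
  let D : ℕ → ι → ℝ := fun x i =>
    2 * (x * stepMoment X 1 x i) + stepMoment X 2 x i + ∑ j, qhat X x i j * b j - b i
  have hD : ∀ i, Tendsto (fun x => D x i) atTop (𝓝 l) := fun i => by
    have h := ((((hML.2.2.1 i).const_mul 2).add (hML.2.2.2 i)).add
      (tendsto_finsetSum Finset.univ fun j _ => (hQ.1 i j).mul_const (b j))).sub_const (b i)
    convert h using 2
    linarith [hb i]
  obtain ⟨M, hM⟩ := exists_abs_le_of_tendsto hD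
  obtain ⟨R, hR⟩ : ∃ R : ℕ, ∀ x, R ≤ x → ∀ i, l / 2 ≤ D x i := by
    have : ∀ᶠ x in atTop, ∀ i, l / 2 ≤ D x i := eventually_all.2 fun i =>
      ((hD i).eventually (lt_mem_nhds (half_lt_self hpos))).mono fun x hx => le_of_lt hx
    exact eventually_atTop.1 this
  set β := ∑ i, |b i| with hβ
  have hbβ : ∀ i, |b i| ≤ β := fun i =>
    Finset.single_le_sum (f := fun i => |b i|) (fun j _ => abs_nonneg _) (Finset.mem_univ i)
  have hβ0 : 0 ≤ β := Finset.sum_nonneg fun j _ => abs_nonneg _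
  set a : ℝ := (R : ℝ) ^ 2 + β with ha
  have ha0 : 0 ≤ a := by positivity
  let f : ℕ × ι → ℝ := fun v => (v.1 : ℝ) ^ 2 + (b v.2 - a)
  let e : ℕ × ι → ℝ := fun v => max (-f v) 0
  let r : ℕ × ι → ℝ := fun v => √(max (f v) 0)
  have hfe : ∀ v, r v ^ 2 = f v + e v := fun v => by
    have : r v ^ 2 = max (f v) 0 := Real.sq_sqrt (le_max_right _ _)
    rw [this]
    rcases max_cases (f v) 0 with ⟨h, h'⟩ | ⟨h, h'⟩ <;>
      rcases max_cases (-f v) 0 with ⟨k, k'⟩ | ⟨k, k'⟩ <;> simp only [e, h, k] <;> linarith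
  have he0 : ∀ v, 0 ≤ e v := fun v => le_max_right _ _
  have hba : ∀ i, |b i - a| ≤ β + a := fun i => by
    have := abs_le.1 (hbβ i)
    rw [abs_le]; constructor <;> linarith
  have he1 : ∀ v, e v ≤ β + a := fun v => by
    have := abs_le.1 (hba v.2)
    have h2 : 0 ≤ (v.1 : ℝ) ^ 2 := by positivity
    exact max_le (by simp only [f]; linarith) (by linarith)
  have hrx : ∀ v : ℕ × ι, (r v - v.1) ^ 2 ≤ β + a := fun v =>
    sq_sqrt_posPart_sub_le (Nat.cast_nonneg _) (hba v.2)
  have hev : Measurable fun ω : ℕ → ℕ × ι => ω 1 := measurable_pi_apply 1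
  have hmeas : ∀ φ : ℕ × ι → ℝ, Measurable fun ω : ℕ → ℕ × ι => φ (ω 1) := fun φ =>
    (measurable_of_countable φ).comp hev
  have hei : ∀ v, Integrable (fun ω => e (ω 1)) (X.P v) := fun v =>
    Integrable.of_bound (hmeas e).aestronglyMeasurable (β + a)
      (ae_of_all _ fun ω => by rw [Real.norm_of_nonneg (he0 _)]; exact he1 _)
  have hbi : ∀ v, Integrable (fun ω => b (ω 1).2) (X.P v) := fun v =>
    Integrable.of_bound (hmeas fun v => b v.2).aestronglyMeasurable β
      (ae_of_all _ fun ω => hbβ _)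
  have h1i : ∀ v : ℕ × ι, Integrable (fun ω => ((ω 1).1 : ℝ) - v.1) (X.P v) := fun v => by
    refine Integrable.mono' ((hC v.1 v.2).1.add (integrable_const 1))
      (hmeas fun u => (u.1 : ℝ) - v.1).aestronglyMeasurable (ae_of_all _ fun ω => ?_)
    rw [Real.norm_eq_abs, Pi.add_apply, ← sq_abs]
    nlinarith [sq_nonneg (|((ω 1).1 : ℝ) - v.1| - 1), abs_nonneg (((ω 1).1 : ℝ) - v.1)]
  have hsplit : ∀ (v : ℕ × ι) (ω : ℕ → ℕ × ι), f (ω 1) =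
      (((ω 1).1 : ℝ) - v.1) ^ 2 + 2 * v.1 * (((ω 1).1 : ℝ) - v.1) + b (ω 1).2
        + ((v.1 : ℝ) ^ 2 - a) := fun v ω => by simp only [f]; ring
  have hfi : ∀ v, Integrable (fun ω => f (ω 1)) (X.P v) := fun v => by
    simp only [hsplit v]
    exact (((hC v.1 v.2).1.add ((h1i v).const_mul _)).add (hbi v)).add (integrable_const _)
  have hfD : ∀ v, ∫ ω, f (ω 1) ∂(X.P v) - f v = D v.1 v.2 := fun v => by
    have i1 : Integrable (fun ω => (((ω 1).1 : ℝ) - v.1) ^ 2) (X.P v) := (hC v.1 v.2).1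
    have i2 := (h1i v).const_mul (2 * (v.1 : ℝ))
    have i3 : Integrable (fun ω => (((ω 1).1 : ℝ) - v.1) ^ 2
      + 2 * v.1 * (((ω 1).1 : ℝ) - v.1)) (X.P v) := i1.add i2
    have i4 : Integrable (fun ω => (((ω 1).1 : ℝ) - v.1) ^ 2
      + 2 * v.1 * (((ω 1).1 : ℝ) - v.1) + b (ω 1).2) (X.P v) := i3.add (hbi v)
    have hq := integral_comp_snd X v.1 v.2 b
    simp only [hsplit v]
    rw [integral_add i4 (integrable_const _), integral_add i3 (hbi v), integral_add i1 i2,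
      integral_const_mul, hq]
    simp only [D, f, stepMoment, pow_one, integral_const, probReal_univ, one_smul]
    ring
  have hdrift : ∀ v, ∫ ω, r (ω 1) ^ 2 ∂(X.P v) - r v ^ 2
      = D v.1 v.2 + (∫ ω, e (ω 1) ∂(X.P v) - e v) := fun v => by
    simp only [hfe]
    rw [integral_add (hfi v) (hei v), ← hfD v]
    ring
  have hEe0 : ∀ v, 0 ≤ ∫ ω, e (ω 1) ∂(X.P v) := fun v => integral_nonneg fun ω => he0 _
  have hEe1 : ∀ v, ∫ ω, e (ω 1) ∂(X.P v) ≤ β + a := fun v => by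
    simpa using integral_mono (hei v) (integrable_const (β + a)) fun ω => he1 (ω 1)
  have hlow : ∀ v, 0 < f v → l / 2 ≤ ∫ ω, r (ω 1) ^ 2 ∂(X.P v) - r v ^ 2 := fun v hv => by
    have he : e v = 0 := max_eq_right (by linarith)
    have hx : R ≤ v.1 := by
      have := (abs_le.1 (hbβ v.2)).2
      have h2 : (R : ℝ) ^ 2 < (v.1 : ℝ) ^ 2 := by simp only [f, ha] at hv; linarith
      exact_mod_cast (lt_of_pow_lt_pow_left₀ 2 (Nat.cast_nonneg _) h2).le
    rw [hdrift, he]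
    linarith [hR v.1 hx v.2, hEe0 v]
  have hsqle : ∀ (v : ℕ × ι) (ω : ℕ → ℕ × ι),
      (r (ω 1) - r v) ^ 2 ≤ 3 * (((ω 1).1 : ℝ) - v.1) ^ 2 + 6 * (β + a) := fun v ω => by
    have h1 := hrx (ω 1)
    have h2 := hrx v
    nlinarith [sq_nonneg (r (ω 1) - (ω 1).1 - (((ω 1).1 : ℝ) - v.1)),
      sq_nonneg (r (ω 1) - (ω 1).1 + (r v - v.1)),
      sq_nonneg ((((ω 1).1 : ℝ) - v.1) + (r v - v.1))]
  have hdom : ∀ v : ℕ × ι, Integrable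
      (fun ω => 3 * (((ω 1).1 : ℝ) - v.1) ^ 2 + 6 * (β + a)) (X.P v) := fun v =>
    ((hC v.1 v.2).1.const_mul 3).add (integrable_const _)
  have hint' : ∀ v, Integrable (fun ω => (r (ω 1) - r v) ^ 2) (X.P v) := fun v =>
    (hdom v).mono' (hmeas fun u => (r u - r v) ^ 2).aestronglyMeasurable
      (ae_of_all _ fun ω => by rw [Real.norm_of_nonneg (sq_nonneg _)]; exact hsqle v ω)
  let K := max (3 * C + 6 * (β + a)) (M + (β + a))
  have hzero := X.drift_eq_zero_of_subinvariant hν1 hν0 hν (r := r) (C := K)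
    (fun v => by simp only [hfe]; exact (hfi v).add (hei v)) hint'
    (fun v => by
      refine (integral_mono (hint' v) (hdom v) (hsqle v)).trans (le_max_of_le_left ?_)
      rw [integral_add ((hC v.1 v.2).1.const_mul 3) (integrable_const _), integral_const_mul]
      simp only [integral_const, probReal_univ, one_smul]
      linarith [(hC v.1 v.2).2])
    (fun v => by
      rcases le_or_gt (f v) 0 with h | h
      · have : r v = 0 := by simp only [r]; rw [max_eq_right h, Real.sqrt_zero]
        rw [this, zero_pow two_ne_zero, sub_zero]
        exact integral_nonneg fun ω => sq_nonneg _
      · linarith [hlow v h])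
    (fun v => by
      rw [hdrift]
      refine le_max_of_le_right ?_
      linarith [(abs_le.1 (hM v.1 v.2)).2, hEe1 v, he0 v])
  obtain ⟨x, hx⟩ := exists_nat_gt (β + a)
  have hxf : 0 < f (x + 1, z.2) := by
    have := (abs_le.1 (hbβ z.2)).1
    simp only [f]
    push_cast
    nlinarith
  linarith [hlow _ hxf, hzero (x + 1, z.2)]

end NullOccupation

section LawOfLargeNumbers

variable {ι : Type*} [Fintype ι] [MeasurableSpace ι] [MeasurableSingletonClass ι]

/-- The compensated sums of `h` along the second coordinate. -/
noncomputable def compensatedSum (X : MChain (ℕ × ι)) (h : ι → ℝ) (n : ℕ)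
    (ω : ℕ → ℕ × ι) : ℝ :=
  ∑ k ∈ Finset.range n, (h (ω (k + 1)).2 - ∑ j, qhat X (ω k).1 (ω k).2 j * h j)

lemma abs_sum_qhat_mul_le (X : MChain (ℕ × ι)) {h : ι → ℝ} {H : ℝ} (hH : ∀ i, |h i| ≤ H)
    (v : ℕ × ι) : |∑ j, qhat X v.1 v.2 j * h j| ≤ H := by
  rw [← integral_comp_snd]
  have hae : ∀ᵐ ω ∂(X.P (v.1, v.2)), ‖h (ω 1).2‖ ≤ H := ae_of_all _ fun ω => hH _
  simpa using norm_integral_le_of_norm_le_const hae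

lemma measurable_compensatedSum (X : MChain (ℕ × ι)) (h : ι → ℝ) (n : ℕ) :
    Measurable[MChain.past (ℕ × ι) n] (compensatedSum X h n) := by
  refine Finset.measurable_fun_sum _ fun k hk => Measurable.sub ?_ ?_
  · exact (measurable_of_countable fun v : ℕ × ι => h v.2).comp
      (MChain.measurable_eval_past (by simpa using hk))
  · exact (measurable_of_countable fun v : ℕ × ι => ∑ j, qhat X v.1 v.2 j * h j).comp
      (MChain.measurable_eval_past (by have := Finset.mem_range.1 hk; omega))

lemma abs_compensatedSum_le (X : MChain (ℕ × ι)) {h : ι → ℝ} {H : ℝ} (hH : ∀ i, |h i| ≤ H)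
    (n : ℕ) (ω : ℕ → ℕ × ι) : |compensatedSum X h n ω| ≤ n * (2 * H) := by
  refine (Finset.abs_sum_le_sum_abs _ _).trans ?_
  refine (Finset.sum_le_card_nsmul _ _ (2 * H) fun k _ => ?_).trans_eq (by simp)
  refine (abs_sub _ _).trans ?_
  linarith [hH (ω (k + 1)).2, abs_sum_qhat_mul_le X hH (ω k)]

lemma integral_compensatedSum_mul (X : MChain (ℕ × ι)) {h : ι → ℝ} {H : ℝ}
    (hH : ∀ i, |h i| ≤ H) (z : ℕ × ι) (n : ℕ) :
    ∫ ω, compensatedSum X h n ω * h (ω (n + 1)).2 ∂(X.P z)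
      = ∫ ω, compensatedSum X h n ω * ∑ j, qhat X (ω n).1 (ω n).2 j * h j ∂(X.P z) := by
  classical
  have hMm := (measurable_compensatedSum X h n).mono (MChain.past_le n) le_rfl
  have hs : ∀ k j, MeasurableSet {ω : ℕ → ℕ × ι | (ω k).2 = j} := fun k j =>
    (measurable_snd.comp (measurable_pi_apply k) : Measurable fun ω : ℕ → ℕ × ι => (ω k).2)
      (measurableSet_singleton j)
  have hMi : Integrable (compensatedSum X h n) (X.P z) :=
    Integrable.of_bound hMm.aestronglyMeasurable _ (ae_of_all _ (abs_compensatedSum_le X hH n))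
  have e1 : ∀ ω : ℕ → ℕ × ι, compensatedSum X h n ω * h (ω (n + 1)).2
      = ∑ j, compensatedSum X h n ω * {ω : ℕ → ℕ × ι | (ω (n + 1)).2 = j}.indicator 1 ω * h j :=
    fun ω => by simp [Set.indicator_apply]
  have e2 : ∀ ω : ℕ → ℕ × ι, compensatedSum X h n ω * ∑ j, qhat X (ω n).1 (ω n).2 j * h j
      = ∑ j, compensatedSum X h n ω * qhat X (ω n).1 (ω n).2 j * h j := fun ω => by
    simp only [Finset.mul_sum, mul_assoc]
  have i1 : ∀ j, Integrable (fun ω => compensatedSum X h n ω *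
      {ω : ℕ → ℕ × ι | (ω (n + 1)).2 = j}.indicator 1 ω) (X.P z) := fun j => by
    refine hMi.mul_bdd (c := 1) ((measurable_one.indicator (hs _ j)).aestronglyMeasurable)
      (ae_of_all _ fun ω => ?_)
    simp only [Set.indicator_apply, Pi.one_apply]
    split_ifs <;> simp
  have i2 : ∀ j, Integrable (fun ω => compensatedSum X h n ω * qhat X (ω n).1 (ω n).2 j)
      (X.P z) := fun j => by
    refine hMi.mul_bdd (c := 1) (((measurable_of_countable fun v : ℕ × ι =>
      qhat X v.1 v.2 j).comp (measurable_pi_apply n)).aestronglyMeasurable)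
      (ae_of_all _ fun ω => ?_)
    rw [qhat, Real.norm_of_nonneg ENNReal.toReal_nonneg]
    exact ENNReal.toReal_le_of_le_ofReal zero_le_one (by simpa using prob_le_one)
  simp only [e1, e2]
  rw [integral_finsetSum _ fun j _ => (i1 j).mul_const _,
    integral_finsetSum _ fun j _ => (i2 j).mul_const _]
  refine Finset.sum_congr rfl fun j _ => ?_
  rw [integral_mul_const, integral_mul_const]
  congr 1
  exact X.integral_mul_shift z n (hs 1 j) (measurable_compensatedSum X h n)
    (abs_compensatedSum_le X hH n)

lemma integral_compensatedSum_sq_le (X : MChain (ℕ × ι)) {h : ι → ℝ} {H : ℝ}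
    (hH : ∀ i, |h i| ≤ H) (z : ℕ × ι) (n : ℕ) :
    ∫ ω, compensatedSum X h n ω ^ 2 ∂(X.P z) ≤ n * (2 * H) ^ 2 := by
  induction n with
  | zero => simp [compensatedSum]
  | succ n ih =>
    have hMm := fun k => (measurable_compensatedSum X h k).mono (MChain.past_le k) le_rfl
    have hMi : Integrable (compensatedSum X h n) (X.P z) := Integrable.of_bound
      (hMm n).aestronglyMeasurable _ (ae_of_all _ (abs_compensatedSum_le X hH n))
    have hm1 : Measurable fun ω : ℕ → ℕ × ι => h (ω (n + 1)).2 :=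
      (measurable_of_countable fun v : ℕ × ι => h v.2).comp (measurable_pi_apply (n + 1))
    have hm2 : Measurable fun ω : ℕ → ℕ × ι => ∑ j, qhat X (ω n).1 (ω n).2 j * h j :=
      (measurable_of_countable fun v : ℕ × ι => ∑ j, qhat X v.1 v.2 j * h j).comp
        (measurable_pi_apply n)
    have i1 : Integrable (fun ω => compensatedSum X h n ω ^ 2) (X.P z) := by
      simp only [sq]
      exact hMi.mul_bdd (hMm n).aestronglyMeasurable (ae_of_all _ (abs_compensatedSum_le X hH n))
    have i2 : Integrable (fun ω => compensatedSum X h n ω * h (ω (n + 1)).2) (X.P z) :=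
      hMi.mul_bdd hm1.aestronglyMeasurable (ae_of_all _ fun ω => hH _)
    have i3 : Integrable (fun ω => compensatedSum X h n ω *
        ∑ j, qhat X (ω n).1 (ω n).2 j * h j) (X.P z) :=
      hMi.mul_bdd hm2.aestronglyMeasurable (ae_of_all _ fun ω => abs_sum_qhat_mul_le X hH (ω n))
    have i4 : Integrable (fun ω => 2 * (compensatedSum X h n ω * h (ω (n + 1)).2 -
        compensatedSum X h n ω * ∑ j, qhat X (ω n).1 (ω n).2 j * h j)) (X.P z) :=
      (i2.sub i3).const_mul 2
    have i5 : Integrable (fun ω => compensatedSum X h n ω ^ 2 +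
        2 * (compensatedSum X h n ω * h (ω (n + 1)).2 -
        compensatedSum X h n ω * ∑ j, qhat X (ω n).1 (ω n).2 j * h j)) (X.P z) := i1.add i4
    have hle : ∀ ω, compensatedSum X h (n + 1) ω ^ 2 ≤ (compensatedSum X h n ω ^ 2 +
        2 * (compensatedSum X h n ω * h (ω (n + 1)).2 -
        compensatedSum X h n ω * ∑ j, qhat X (ω n).1 (ω n).2 j * h j)) + (2 * H) ^ 2 := by
      intro ω
      have e : compensatedSum X h (n + 1) ω = compensatedSum X h n ω
          + (h (ω (n + 1)).2 - ∑ j, qhat X (ω n).1 (ω n).2 j * h j) := Finset.sum_range_succ _ _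
      have hb : |h (ω (n + 1)).2 - ∑ j, qhat X (ω n).1 (ω n).2 j * h j| ≤ 2 * H :=
        (abs_sub _ _).trans (by linarith [hH (ω (n + 1)).2, abs_sum_qhat_mul_le X hH (ω n)])
      have hb2 := sq_le_sq' (abs_le.1 hb).1 (abs_le.1 hb).2
      rw [e]
      nlinarith
    calc _ ≤ ∫ ω, ((compensatedSum X h n ω ^ 2 +
          2 * (compensatedSum X h n ω * h (ω (n + 1)).2 -
          compensatedSum X h n ω * ∑ j, qhat X (ω n).1 (ω n).2 j * h j)) + (2 * H) ^ 2)
            ∂(X.P z) :=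
          integral_mono_of_nonneg (ae_of_all _ fun ω => sq_nonneg _)
            (i5.add (integrable_const _)) (ae_of_all _ hle)
      _ ≤ _ := by
          rw [integral_add i5 (integrable_const _), integral_add i1 i4, integral_const_mul,
            integral_sub i2 i3, integral_compensatedSum_mul X hH]
          simp only [integral_const, probReal_univ, one_smul]
          push_cast
          linarith

lemma integral_abs_compensatedSum_le (X : MChain (ℕ × ι)) {h : ι → ℝ} {H : ℝ}
    (hH : ∀ i, |h i| ≤ H) (z : ℕ × ι) {n : ℕ} (hn : 0 < n) :
    (∫ ω, |compensatedSum X h n ω| ∂(X.P z)) / n ≤ (1 + (2 * H) ^ 2) / 2 / √n := by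
  have hn' : (0 : ℝ) < √n := Real.sqrt_pos.2 (by exact_mod_cast hn)
  have hnn : √(n : ℝ) * √n = n := Real.mul_self_sqrt (Nat.cast_nonneg _)
  have hMm := (measurable_compensatedSum X h n).mono (MChain.past_le n) le_rfl
  have i1 : Integrable (fun ω => compensatedSum X h n ω ^ 2) (X.P z) :=
    Integrable.of_bound (hMm.pow_const 2).aestronglyMeasurable ((n * (2 * H)) ^ 2)
      (ae_of_all _ fun ω => by
        rw [Real.norm_of_nonneg (sq_nonneg _), ← sq_abs]
        exact pow_le_pow_left₀ (abs_nonneg _) (abs_compensatedSum_le X hH n ω) 2)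
  have h1 : ∫ ω, 2 * √n * |compensatedSum X h n ω| ∂(X.P z)
      ≤ ∫ ω, (compensatedSum X h n ω ^ 2 + n) ∂(X.P z) := by
    refine integral_mono_of_nonneg (ae_of_all _ fun ω => by positivity)
      (i1.add (integrable_const _)) (ae_of_all _ fun ω => ?_)
    simp only
    rw [← sq_abs]
    nlinarith [sq_nonneg (|compensatedSum X h n ω| - √n)]
  rw [integral_const_mul, integral_add i1 (integrable_const _)] at h1
  simp only [integral_const, probReal_univ, one_smul] at h1
  have h2 := integral_compensatedSum_sq_le X hH z n
  rw [div_div, div_le_div_iff₀ (by exact_mod_cast hn) (by positivity)]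
  nlinarith

/-- The number of visits of the second coordinate to `i` before time `n`. -/
noncomputable def visitCount (i : ι) (n : ℕ) (ω : ℕ → ℕ × ι) : ℝ :=
  open Classical in ∑ k ∈ Finset.range n, if (ω k).2 = i then 1 else 0

lemma measurable_visitCount (i : ι) (n : ℕ) : Measurable (visitCount i n) := by
  classical
  exact Finset.measurable_fun_sum _ fun k _ =>
    (measurable_of_countable fun v : ℕ × ι => if v.2 = i then (1 : ℝ) else 0).comp
      (measurable_pi_apply k)

/-- Weak law of large numbers, in `L¹`, for the visits of the second coordinate to a state. -/
theorem tendsto_integral_abs_visitCount_sub [DecidableEq ι] {X : MChain (ℕ × ι)} {z : ℕ × ι}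
    (hocc : ∀ v, Tendsto (fun n => X.occupation z n v) atTop (𝓝 0)) {Q : ι → ι → ℝ}
    (hQ : CondQ X Q) {w : ι → ℝ} (hw : IsStationaryDist Q w) (i : ι) :
    Tendsto (fun n : ℕ => (∫ ω, |visitCount i n ω - n * w i| ∂(X.P z)) / n) atTop (𝓝 0) := by
  obtain ⟨h, hh⟩ := exists_poisson_solution hQ.2.1 hQ.2.2 hw fun j => if j = i then (1 : ℝ) else 0
  have hh : ∀ j, h j - ∑ k, Q j k * h k = (if j = i then 1 else 0) - w i := fun j => by
    simpa using hh j
  set H := ∑ j, |h j|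
  have hH : ∀ j, |h j| ≤ H := fun j =>
    Finset.single_le_sum (f := fun j => |h j|) (fun j _ => abs_nonneg _) (Finset.mem_univ j)
  let φ : ℕ × ι → ℝ := fun v => |∑ j, qhat X v.1 v.2 j * h j - ∑ j, Q v.2 j * h j|
  have hφ0 : ∀ v, 0 ≤ φ v := fun v => abs_nonneg _
  have hφlim : ∀ j, Tendsto (fun x => φ (x, j)) atTop (𝓝 0) := fun j => by
    have := ((tendsto_finsetSum Finset.univ fun k _ => (hQ.1 j k).mul_const (h k)).sub_const
      (∑ k, Q j k * h k)).abs
    simpa using this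
  obtain ⟨B, hB⟩ := exists_abs_le_of_tendsto (D := fun x j => φ (x, j)) hφlim
  have hφB : ∀ v, φ v ≤ B := fun v => (le_abs_self _).trans (hB v.1 v.2)
  have hdecomp : ∀ n ω, visitCount i n ω - n * w i = h (ω 0).2 - h (ω n).2
      + compensatedSum X h n ω + ∑ k ∈ Finset.range n,
        (∑ j, qhat X (ω k).1 (ω k).2 j * h j - ∑ j, Q (ω k).2 j * h j) := by
    intro n ω
    induction n with
    | zero => simp [visitCount, compensatedSum]
    | succ n ih =>
      have hn := hh (ω n).2
      simp only [visitCount, compensatedSum, Finset.sum_range_succ] at ih ⊢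
      push_cast
      by_cases hi : (ω n).2 = i <;> simp only [hi, if_true, if_false] at hn ih ⊢ <;> linarith
  have hmφ : ∀ k, Measurable fun ω : ℕ → ℕ × ι => φ (ω k) := fun k =>
    (measurable_of_countable φ).comp (measurable_pi_apply k)
  have hφi : ∀ k, Integrable (fun ω => φ (ω k)) (X.P z) := fun k =>
    Integrable.of_bound (hmφ k).aestronglyMeasurable B (ae_of_all _ fun ω => by
      rw [Real.norm_of_nonneg (hφ0 _)]; exact hφB _)
  have hMi : ∀ n, Integrable (fun ω => |compensatedSum X h n ω|) (X.P z) := fun n =>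
    (Integrable.of_bound ((measurable_compensatedSum X h n).mono (MChain.past_le n)
      le_rfl).aestronglyMeasurable _ (ae_of_all _ (abs_compensatedSum_le X hH n))).abs
  have hφavg : Tendsto (fun n : ℕ => (∑ k ∈ Finset.range n, ∫ ω, φ (ω k) ∂(X.P z)) / n)
      atTop (𝓝 0) := by
    have h1 := X.tendsto_average_of_tendsto_occupation hocc (φ := fun v => ENNReal.ofReal (φ v))
      (C := ENNReal.ofReal B) ENNReal.ofReal_ne_top
      (fun v => ENNReal.ofReal_le_ofReal (hφB v)) (fun ε hε => by
        have : ∀ᶠ x in atTop, ∀ j, ENNReal.ofReal (φ (x, j)) ≤ ε := eventually_all.2 fun j => by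
          have := ENNReal.tendsto_ofReal (hφlim j)
          rw [ENNReal.ofReal_zero] at this
          exact ENNReal.tendsto_nhds_zero.1 this ε hε
        obtain ⟨R, hR⟩ := eventually_atTop.1 this
        refine ((Set.finite_Iio R).prod (Set.finite_univ (α := ι))).subset fun v hv => ?_
        refine ⟨?_, Set.mem_univ _⟩
        by_contra hx
        exact absurd (hR v.1 (not_lt.1 hx) v.2) (not_le.2 hv))
    have h2 := (ENNReal.tendsto_toReal ENNReal.zero_ne_top).comp h1
    refine h2.congr fun n => ?_
    simp only [Function.comp_apply, ENNReal.toReal_div, ENNReal.toReal_natCast]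
    rw [ENNReal.toReal_sum fun k _ => (hφi k).lintegral_lt_top.ne]
    congr 1
    refine Finset.sum_congr rfl fun k _ => ?_
    exact (integral_eq_lintegral_of_nonneg_ae (ae_of_all _ fun ω => hφ0 _)
      (hmφ k).aestronglyMeasurable).symm
  have hbound : ∀ n : ℕ, 0 < n → (∫ ω, |visitCount i n ω - n * w i| ∂(X.P z)) / n
      ≤ 2 * H / n + (1 + (2 * H) ^ 2) / 2 / √n
        + (∑ k ∈ Finset.range n, ∫ ω, φ (ω k) ∂(X.P z)) / n := by
    intro n hn
    have hn' : (0 : ℝ) < n := by exact_mod_cast hn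
    have i1 : Integrable (fun ω => 2 * H + |compensatedSum X h n ω|) (X.P z) :=
      (integrable_const _).add (hMi n)
    have i2 : Integrable (fun ω : ℕ → ℕ × ι => ∑ k ∈ Finset.range n, φ (ω k)) (X.P z) :=
      integrable_finsetSum _ fun k _ => hφi k
    have h1 : ∫ ω, |visitCount i n ω - n * w i| ∂(X.P z)
        ≤ ∫ ω, (2 * H + |compensatedSum X h n ω| + ∑ k ∈ Finset.range n, φ (ω k)) ∂(X.P z) := by
      refine integral_mono_of_nonneg (ae_of_all _ fun ω => abs_nonneg _) (i1.add i2)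
        (ae_of_all _ fun ω => ?_)
      simp only
      rw [hdecomp]
      refine (abs_add_le _ _).trans (add_le_add ((abs_add_le _ _).trans
        (add_le_add ((abs_sub _ _).trans ?_) le_rfl)) (Finset.abs_sum_le_sum_abs _ _))
      linarith [hH (ω 0).2, hH (ω n).2]
    rw [integral_add i1 i2, integral_add (integrable_const _) (hMi n),
      integral_finsetSum _ fun k _ => hφi k] at h1
    simp only [integral_const, probReal_univ, one_smul] at h1
    calc _ ≤ (2 * H + ∫ ω, |compensatedSum X h n ω| ∂(X.P z)
          + ∑ k ∈ Finset.range n, ∫ ω, φ (ω k) ∂(X.P z)) / n := by gcongr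
      _ ≤ _ := by
        rw [add_div, add_div]
        exact add_le_add (add_le_add le_rfl (integral_abs_compensatedSum_le X hH z hn)) le_rfl
  have hlim : Tendsto (fun n : ℕ => 2 * H / n + (1 + (2 * H) ^ 2) / 2 / √n
      + (∑ k ∈ Finset.range n, ∫ ω, φ (ω k) ∂(X.P z)) / n) atTop (𝓝 0) := by
    have h1 : Tendsto (fun n : ℕ => 2 * H / n) atTop (𝓝 0) :=
      tendsto_const_div_atTop_nhds_zero_nat _
    have h2 : Tendsto (fun n : ℕ => (1 + (2 * H) ^ 2) / 2 / √(n : ℝ)) atTop (𝓝 0) :=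
      tendsto_const_nhds.div_atTop (Real.tendsto_sqrt_atTop.comp tendsto_natCast_atTop_atTop)
    simpa using (h1.add h2).add hφavg
  refine squeeze_zero' (Eventually.of_forall fun n => ?_) ?_ hlim
  · exact div_nonneg (integral_nonneg fun ω => abs_nonneg _) (Nat.cast_nonneg _)
  · filter_upwards [eventually_gt_atTop 0] with n hn using hbound n hn

/-- Weak law of large numbers for the visits of the second coordinate to a state. -/
theorem tendsto_measure_visitCount {X : MChain (ℕ × ι)} {z : ℕ × ι} {i : ι} {q : ℝ}
    (h : Tendsto (fun n : ℕ => (∫ ω, |visitCount i n ω - n * q| ∂(X.P z)) / n) atTop (𝓝 0))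
    {ε : ℝ} (hε : 0 < ε) :
    Tendsto (fun n : ℕ => (X.P z).real {ω | ε ≤ |visitCount i n ω / n - q|}) atTop (𝓝 0) := by
  have h' := h.const_mul ε⁻¹
  rw [mul_zero] at h'
  refine squeeze_zero' (Eventually.of_forall fun n => measureReal_nonneg) ?_ h'
  filter_upwards [eventually_gt_atTop 0] with n hn
  have hn' : (0 : ℝ) < n := by exact_mod_cast hn
  have e : ∀ ω, |visitCount i n ω - n * q| = n * |visitCount i n ω / n - q| := fun ω => by
    rw [← abs_of_pos hn', ← abs_mul, abs_of_pos hn', mul_sub, mul_div_cancel₀ _ hn'.ne']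
  have hV : ∀ ω, |visitCount i n ω| ≤ n := fun ω => by
    classical
    refine (Finset.abs_sum_le_sum_abs _ _).trans ?_
    refine (Finset.sum_le_card_nsmul _ _ 1 fun k _ => ?_).trans_eq (by simp)
    split_ifs <;> simp
  have hi : Integrable (fun ω => |visitCount i n ω / n - q|) (X.P z) :=
    (((Integrable.of_bound (measurable_visitCount i n).aestronglyMeasurable _
      (ae_of_all _ hV)).div_const _).sub (integrable_const q)).abs
  have hmk := mul_meas_ge_le_integral_of_nonneg (ae_of_all _ fun ω => abs_nonneg _) hi ε
  simp only [e]
  rw [integral_const_mul, mul_div_cancel_left₀ _ hn'.ne', ← div_eq_inv_mul, le_div_iff₀ hε,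
    mul_comm]
  exact hmk

end LawOfLargeNumbers

section RenewalCounting

lemma visitCount_eq_count {ι : Type*} [DecidableEq ι] (i : ι) (n : ℕ) (ω : ℕ → ℕ × ι) :
    visitCount i n ω = Nat.count (fun k => (ω k).2 = i) n := by
  rw [visitCount, Nat.count_eq_card_filter_range, Finset.card_filter, Nat.cast_sum]
  refine Finset.sum_congr rfl fun k _ => ?_
  by_cases hk : (ω k).2 = i <;> simp [hk]

lemma tauSeq_eq_nth {ι : Type*} (i : ι) (ω : ℕ → ℕ × ι) (hinf : {n | (ω n).2 = i}.Infinite)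
    (k : ℕ) :
    tauSeq i ω k = Nat.nth (fun n => (ω n).2 = i) k := by
  induction k with
  | zero => rw [tauSeq, Nat.nth_zero]
  | succ k ih =>
    rw [tauSeq, Nat.nth_eq_sInf, ih]
    congr 1
    ext x
    refine ⟨fun hx => ⟨hx.2, fun m hm => ?_⟩, fun hx => ⟨hx.2 k k.lt_succ_self, hx.1⟩⟩
    exact (Nat.nth_monotone hinf (Nat.le_of_lt_succ hm)).trans_lt hx.1

variable {ι : Type*} [DecidableEq ι]

lemma abs_Ncount_sub_visitCount_le (i : ι) (n : ℕ) (ω : ℕ → ℕ × ι)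
    (hinf : {n | (ω n).2 = i}.Infinite) : |(Ncount i n ω : ℝ) - visitCount i n ω| ≤ 1 := by
  have hset : {k | tauSeq i ω k ≤ n}
      = Set.Iio (Nat.count (fun k => (ω k).2 = i) (n + 1)) := by
    ext k
    rw [Set.mem_ofPred_eq, tauSeq_eq_nth i ω hinf, Set.mem_Iio, ← Nat.lt_succ_iff, ← not_le,
      ← Nat.count_le_iff_le_nth hinf, not_le]
  have hN : Ncount i n ω = Nat.count (fun k => (ω k).2 = i) (n + 1) - 1 := by
    rw [Ncount, hset]
    rcases Nat.eq_zero_or_pos (Nat.count (fun k => (ω k).2 = i) (n + 1)) with h0 | h0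
    · simp [h0]
    · refine IsGreatest.csSup_eq ⟨?_, fun k hk => ?_⟩
      · exact Nat.sub_lt h0 one_pos
      · exact Nat.le_sub_one_of_lt hk
  rw [visitCount_eq_count, hN, Nat.count_succ]
  have h1 : ∀ a b : ℕ, a ≤ b + 1 → b ≤ a + 1 → |(a : ℝ) - b| ≤ 1 := fun a b hab hba => by
    have hab' : (a : ℝ) ≤ b + 1 := by exact_mod_cast hab
    have hba' : (b : ℝ) ≤ a + 1 := by exact_mod_cast hba
    rw [abs_le]; constructor <;> linarith
  refine h1 _ _ ?_ ?_ <;> split_ifs <;> omega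

variable [MeasurableSpace ι]

lemma measure_finite_visits_eq_zero {X : MChain (ℕ × ι)} {z : ℕ × ι} {i : ι} {q : ℝ} (hq : 0 < q)
    (h : ∀ ε : ℝ, 0 < ε → Tendsto
      (fun n : ℕ => (X.P z).real {ω | ε ≤ |visitCount i n ω / n - q|}) atTop (𝓝 0)) :
    X.P z {ω | {n | (ω n).2 = i}.Finite} = 0 := by
  have hsub : {ω : ℕ → ℕ × ι | {n | (ω n).2 = i}.Finite}
      ⊆ ⋃ m : ℕ, {ω | ∀ n, visitCount i n ω ≤ m} := fun ω hω => by
    refine Set.mem_iUnion.2 ⟨(Set.Finite.toFinset hω).card, fun n => ?_⟩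
    rw [visitCount_eq_count, Nat.count_eq_card_filter_range, Nat.cast_le]
    exact Finset.card_le_card fun k hk => by simpa using (Finset.mem_filter.1 hk).2
  refine measure_mono_null hsub (measure_iUnion_null fun m => ?_)
  have hlim := h (q / 2) (by positivity)
  have hle : ∀ᶠ n : ℕ in atTop, (X.P z).real {ω | ∀ n, visitCount i n ω ≤ m}
      ≤ (X.P z).real {ω | q / 2 ≤ |visitCount i n ω / n - q|} := by
    have hm : Tendsto (fun n : ℕ => (m : ℝ) / n) atTop (𝓝 0) :=
      tendsto_const_div_atTop_nhds_zero_nat _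
    filter_upwards [hm.eventually (gt_mem_nhds (half_pos hq))] with n hn
    refine measureReal_mono fun ω hω => ?_
    have h1 : visitCount i n ω / n ≤ m / n := by
      gcongr
      exact hω n
    rw [Set.mem_ofPred_eq, abs_sub_comm]
    exact le_trans (by linarith) (le_abs_self _)
  have h0 : (X.P z).real {ω | ∀ n, visitCount i n ω ≤ m} ≤ 0 := ge_of_tendsto hlim hle
  exact (measureReal_eq_zero_iff).1 (le_antisymm h0 measureReal_nonneg)

/-- Transfer of the weak law of large numbers from the visit counts to `Ncount`. -/
theorem tendsto_measure_Ncount {X : MChain (ℕ × ι)} {z : ℕ × ι} {i : ι} {q : ℝ} (hq : 0 < q)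
    (h : ∀ ε : ℝ, 0 < ε → Tendsto
      (fun n : ℕ => (X.P z).real {ω | ε ≤ |visitCount i n ω / n - q|}) atTop (𝓝 0))
    {ε : ℝ} (hε : 0 < ε) :
    Tendsto (fun n : ℕ => (X.P z).real {ω | ε ≤ |(Ncount i n ω : ℝ) / n - q|}) atTop (𝓝 0) := by
  refine squeeze_zero' (Eventually.of_forall fun n => measureReal_nonneg) ?_ (h _ (half_pos hε))
  have h1 : Tendsto (fun n : ℕ => (1 : ℝ) / n) atTop (𝓝 0) :=
    tendsto_const_div_atTop_nhds_zero_nat _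
  filter_upwards [h1.eventually (gt_mem_nhds (half_pos hε))] with n hn
  have hsub : {ω | ε ≤ |(Ncount i n ω : ℝ) / n - q|}
      ⊆ {ω | ε / 2 ≤ |visitCount i n ω / n - q|} ∪ {ω | {n | (ω n).2 = i}.Finite} := by
    intro ω hω
    by_cases hfin : {n | (ω n).2 = i}.Finite
    · exact Or.inr hfin
    refine Or.inl ?_
    have h2 : |(Ncount i n ω : ℝ) / n - visitCount i n ω / n| ≤ 1 / n := by
      rw [← sub_div, abs_div, Nat.abs_cast]
      gcongr
      exact abs_Ncount_sub_visitCount_le i n ω hfin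
    have h3 := abs_sub_le ((Ncount i n ω : ℝ) / n) (visitCount i n ω / n) q
    have h4 : ε ≤ |(Ncount i n ω : ℝ) / n - q| := hω
    rw [Set.mem_ofPred_eq]
    linarith
  refine (measureReal_mono hsub).trans ((measureReal_union_le _ _).trans_eq ?_)
  rw [measureReal_def (X.P z) {ω | {n | (ω n).2 = i}.Finite}, measure_finite_visits_eq_zero hq h]
  simp

end RenewalCounting

/-- Lemma (renewal counting): under (B_p) for some `p > 2`, (Q_∞) and (M_L), if
`Σ_i (2c_i + s_i²) π(i) > 0`, then `n^{-1} N(n) → π(s0)` in probability. -/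
theorem stmt19 (X : MChain (ℕ × S)) (hirr : X.Irreducible) (s0 : S)
    (p : ℝ) (hp : 2 < p) (hB : CondB X p)
    (Q : S → S → ℝ) (pst : S → ℝ) (hQ : CondQ X Q) (hpst : IsStationaryDist Q pst)
    (c s2 : S → ℝ) (hML : CondML X c s2)
    (hpos : 0 < ∑ i, (2 * c i + s2 i) * pst i) :
    ∀ (z : ℕ × S) (ε : ℝ), 0 < ε →
      Tendsto (fun n : ℕ =>
          (X.P z {ω | ε ≤ |((Ncount s0 n ω : ℝ)) / n - pst s0|}).toReal)
        atTop (nhds 0) := by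
  intro z ε hε
  have hocc := fun v => tendsto_occupation_zero hirr hp hB hQ hpst hML hpos z v
  exact tendsto_measure_Ncount (hpst.1 s0) (fun δ hδ => tendsto_measure_visitCount
    (tendsto_integral_abs_visitCount_sub hocc hQ hpst s0) hδ) hε
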